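/- arXiv:2105.05138 — 2 statements merged into one kernel-verified Lean document; each statement's English description precedes it below -/
import Mathlib

section
/- Let n ≥ 1 and suppose q_i·n is an integer for every i ∈ {1,…,p+1}. For every distribution π on {0,1}^p, the following are equivalent: (a) for every inconsistent α ∈ {0,1}^{p+1}, the polyhedron H_α is not active at (π, n) — i.e. it is not the case that π ∈ H_{α,≤0} and some profile P of n agents has Hist(P) ∈ H_α; (b) every effective refinement of π at n is consistent. -/
/-- A judgement on `p` premises: a vector in `{0,1}^p`, encoded as `Fin p → Bool`. -/
abbrev Judg (p : ℕ) : Type := Fin p → Bool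

noncomputable section

/-- `Ω_i`: for a premise index `i < p`, the set of judgements whose `i`-th premise is `1`;
for the conclusion index `i = p`, the set of judgements `ω` with `f ω = 1`. -/
def Omega (p : ℕ) (f : Judg p → Bool) (i : Fin (p + 1)) : Finset (Judg p) :=
  if h : (i : ℕ) < p then Finset.univ.filter (fun ω => ω ⟨(i : ℕ), h⟩ = true)
  else Finset.univ.filter (fun ω => f ω = true)

/-- The vector `c_i ∈ ℝ^({0,1}^p)`: `c_i(ω) = q_i - 1` if `ω ∈ Ω_i`, else `q_i`. -/
def cvec (p : ℕ) (f : Judg p → Bool) (q : Fin (p + 1) → ℝ) (i : Fin (p + 1)) :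
    Judg p → ℝ :=
  fun ω => if ω ∈ Omega p f i then q i - 1 else q i

/-- Euclidean inner product on `ℝ^({0,1}^p)`. -/
def inn (p : ℕ) (u v : Judg p → ℝ) : ℝ := ∑ ω : Judg p, u ω * v ω

/-- The histogram of a profile: how many agents cast each judgement. -/
def Hist (p n : ℕ) (P : Fin n → Judg p) (ω : Judg p) : ℕ :=
  (Finset.univ.filter (fun j => P j = ω)).card

/-- The histogram, viewed as a vector in `ℝ^({0,1}^p)`. -/
def HistR (p n : ℕ) (P : Fin n → Judg p) : Judg p → ℝ :=
  fun ω => (Hist p n P ω : ℝ)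

/-- `n_i(P)`: the number of agents of `P` whose judgement lies in `Ω_i`. -/
def nOnes (p n : ℕ) (f : Judg p → Bool) (P : Fin n → Judg p) (i : Fin (p + 1)) : ℕ :=
  ∑ ω ∈ Omega p f i, Hist p n P ω

/-- The quota rule on profiles, with thresholds `q` and tie-breakings `d`. -/
def quota (p n : ℕ) (f : Judg p → Bool) (q : Fin (p + 1) → ℝ) (d : Fin (p + 1) → Bool)
    (P : Fin n → Judg p) (i : Fin (p + 1)) : Bool := by
  classical
  exact if (nOnes p n f P i : ℝ) > q i * (n : ℝ) then true
    else if (nOnes p n f P i : ℝ) = q i * (n : ℝ) then d i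
    else false

/-- The real value of a bit: `1` for `1`/true, `0` for `0`/false. -/
def bval (b : Bool) : ℝ := if b then 1 else 0

/-- `sign(1) = 1` and `sign(0) = -1`. -/
def sgn (b : Bool) : ℝ := if b then 1 else -1

/-- `α ∈ {0,1}^{p+1}` is consistent if its conclusion component equals `f` applied to
its premise components. -/
def Consistent (p : ℕ) (f : Judg p → Bool) (α : Fin (p + 1) → Bool) : Prop :=
  α (Fin.last p) = f (fun j => α j.castSucc)

/-- A profile is a doctrinal paradox if the quota-rule output is inconsistent. -/
def Paradox (p n : ℕ) (f : Judg p → Bool) (q : Fin (p + 1) → ℝ) (d : Fin (p + 1) → Bool)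
    (P : Fin n → Judg p) : Prop :=
  ¬ Consistent p f (quota p n f q d P)

/-- The polyhedron `H_α`. -/
def polyH (p : ℕ) (f : Judg p → Bool) (q : Fin (p + 1) → ℝ) (d : Fin (p + 1) → Bool)
    (α : Fin (p + 1) → Bool) : Set (Judg p → ℝ) :=
  {x | ∀ i : Fin (p + 1),
    sgn (α i) * inn p (cvec p f q i) x ≤ sgn (α i) * bval (d i) - bval (α i)}

/-- The characteristic cone `H_{α,≤0}`. -/
def coneH (p : ℕ) (f : Judg p → Bool) (q : Fin (p + 1) → ℝ)
    (α : Fin (p + 1) → Bool) : Set (Judg p → ℝ) :=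
  {x | ∀ i : Fin (p + 1), sgn (α i) * inn p (cvec p f q i) x ≤ 0}

/-- A probability distribution on `{0,1}^p`. -/
def IsDistribution (p : ℕ) (π : Judg p → ℝ) : Prop :=
  (∀ ω, 0 ≤ π ω) ∧ ∑ ω : Judg p, π ω = 1

/-- `pr_i(π) = Σ_{ω ∈ Ω_i} π(ω)`. -/
def pr (p : ℕ) (f : Judg p → Bool) (π : Judg p → ℝ) (i : Fin (p + 1)) : ℝ :=
  ∑ ω ∈ Omega p f i, π ω

/-- The quota rule applied to a distribution. -/
def quotaDist (p : ℕ) (f : Judg p → Bool) (q : Fin (p + 1) → ℝ) (d : Fin (p + 1) → Bool)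
    (π : Judg p → ℝ) (i : Fin (p + 1)) : Bool := by
  classical
  exact if pr p f π i > q i then true
    else if pr p f π i = q i then d i
    else false

/-- `α` is a refinement of `π`: it matches `r(π)` on every non-tied proposition. -/
def Refines (p : ℕ) (f : Judg p → Bool) (q : Fin (p + 1) → ℝ) (d : Fin (p + 1) → Bool)
    (π : Judg p → ℝ) (α : Fin (p + 1) → Bool) : Prop :=
  ∀ i : Fin (p + 1), pr p f π i ≠ q i → α i = quotaDist p f q d π i

/-- `α` is an effective refinement of `π` at `n`: a refinement realized by some profile. -/
def EffRef (p n : ℕ) (f : Judg p → Bool) (q : Fin (p + 1) → ℝ) (d : Fin (p + 1) → Bool)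
    (π : Judg p → ℝ) (α : Fin (p + 1) → Bool) : Prop :=
  Refines p f q d π α ∧ ∃ P : Fin n → Judg p, quota p n f q d P = α

/-- The probability that a random profile drawn from the independent (non-identical)
product of `vπ` is a doctrinal paradox. -/
def probParadox (p n : ℕ) (f : Judg p → Bool) (q : Fin (p + 1) → ℝ)
    (d : Fin (p + 1) → Bool) (vπ : Fin n → Judg p → ℝ) : ℝ := by
  classical
  exact ∑ P : Fin n → Judg p,
    if Paradox p n f q d P then ∏ j : Fin n, vπ j (P j) else 0

/-- The max-smoothed likelihood of the doctrinal paradox. -/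
def DPmax (p n : ℕ) (f : Judg p → Bool) (q : Fin (p + 1) → ℝ) (d : Fin (p + 1) → Bool)
    (D : Set (Judg p → ℝ)) : ℝ :=
  sSup {x : ℝ | ∃ vπ : Fin n → Judg p → ℝ,
    (∀ j, vπ j ∈ D) ∧ x = probParadox p n f q d vπ}

/-- The min-smoothed likelihood of the doctrinal paradox. -/
def DPmin (p n : ℕ) (f : Judg p → Bool) (q : Fin (p + 1) → ℝ) (d : Fin (p + 1) → Bool)
    (D : Set (Judg p → ℝ)) : ℝ :=
  sInf {x : ℝ | ∃ vπ : Fin n → Judg p → ℝ,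
    (∀ j, vπ j ∈ D) ∧ x = probParadox p n f q d vπ}

/-- Condition `κ1(n)`: no profile of `n` agents is a doctrinal paradox. -/
def kappa1 (p n : ℕ) (f : Judg p → Bool) (q : Fin (p + 1) → ℝ)
    (d : Fin (p + 1) → Bool) : Prop :=
  ∀ P : Fin n → Judg p, ¬ Paradox p n f q d P

/-- Condition `κ2(n)`: every effective refinement at `n` of every `π` in the convex hull
of `D` is consistent. -/
def kappa2 (p n : ℕ) (f : Judg p → Bool) (q : Fin (p + 1) → ℝ) (d : Fin (p + 1) → Bool)
    (D : Set (Judg p → ℝ)) : Prop :=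
  ∀ π ∈ convexHull ℝ D, ∀ α : Fin (p + 1) → Bool,
    EffRef p n f q d π α → Consistent p f α

/-- Condition `κ3(n)`: some `π` in the convex hull of `D` has all its effective
refinements at `n` consistent. -/
def kappa3 (p n : ℕ) (f : Judg p → Bool) (q : Fin (p + 1) → ℝ) (d : Fin (p + 1) → Bool)
    (D : Set (Judg p → ℝ)) : Prop :=
  ∃ π ∈ convexHull ℝ D, ∀ α : Fin (p + 1) → Bool,
    EffRef p n f q d π α → Consistent p f α

/-- Condition `κ4`: the conclusion depends on exactly one premise, with matching
thresholds. -/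
def kappa4 (p : ℕ) (f : Judg p → Bool) (q : Fin (p + 1) → ℝ) : Prop :=
  ∃ i : Fin p,
    ((∀ ω : Judg p, f ω = ω i) ∧ q (Fin.last p) = q i.castSucc) ∨
    ((∀ ω : Judg p, f ω = !(ω i)) ∧ q (Fin.last p) = 1 - q i.castSucc)

/-- `D` is strictly positive: some `ε > 0` lower-bounds every probability. -/
def StrictlyPositive (p : ℕ) (D : Set (Judg p → ℝ)) : Prop :=
  ∃ ε > (0 : ℝ), ∀ π ∈ D, ∀ ω : Judg p, ε ≤ π ω

theorem inn_cvec (p : ℕ) (f : Judg p → Bool) (q : Fin (p + 1) → ℝ) (i : Fin (p + 1))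
    (x : Judg p → ℝ) :
    inn p (cvec p f q i) x = q i * ∑ ω, x ω - ∑ ω ∈ Omega p f i, x ω := by
  have h : ∑ ω ∈ Omega p f i, x ω = ∑ ω, if ω ∈ Omega p f i then x ω else 0 := by
    rw [Finset.sum_ite_mem, Finset.univ_inter]
  rw [h, inn, Finset.mul_sum, ← Finset.sum_sub_distrib]
  refine Finset.sum_congr rfl fun ω _ => ?_
  unfold cvec
  split_ifs <;> ring

theorem sum_HistR (p n : ℕ) (P : Fin n → Judg p) : ∑ ω, HistR p n P ω = n := by
  unfold HistR Hist
  rw [← Nat.cast_sum, ← Finset.card_eq_sum_card_fiberwise fun j _ => by simp]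
  simp

theorem inn_cvec_HistR (p n : ℕ) (f : Judg p → Bool) (q : Fin (p + 1) → ℝ) (i : Fin (p + 1))
    (P : Fin n → Judg p) :
    inn p (cvec p f q i) (HistR p n P) = q i * n - nOnes p n f P i := by
  rw [inn_cvec, sum_HistR, nOnes, Nat.cast_sum]
  rfl

theorem HistR_mem_polyH_iff (p n : ℕ) (f : Judg p → Bool) (q : Fin (p + 1) → ℝ)
    (d : Fin (p + 1) → Bool) (hint : ∀ i : Fin (p + 1), ∃ k : ℤ, q i * (n : ℝ) = (k : ℝ))
    (P : Fin n → Judg p) (α : Fin (p + 1) → Bool) :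
    HistR p n P ∈ polyH p f q d α ↔ quota p n f q d P = α := by
  rw [funext_iff]
  refine forall_congr' fun i => ?_
  obtain ⟨k, hk⟩ := hint i
  rw [inn_cvec_HistR, quota, hk]
  generalize nOnes p n f P i = N
  have hN : (N : ℝ) = ((N : ℤ) : ℝ) := by simp
  rw [hN]
  generalize (N : ℤ) = m
  cases α i <;> cases d i <;> simp only [sgn, bval] <;> norm_num <;> norm_cast <;> grind

theorem mem_coneH_iff (p : ℕ) (f : Judg p → Bool) (q : Fin (p + 1) → ℝ)
    (d : Fin (p + 1) → Bool) (π : Judg p → ℝ) (hπ : ∑ ω, π ω = 1) (α : Fin (p + 1) → Bool) :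
    π ∈ coneH p f q α ↔ Refines p f q d π α := by
  refine forall_congr' fun i => ?_
  rw [inn_cvec, hπ, mul_one, ← pr, quotaDist]
  cases α i <;> simp only [sgn] <;> grind

/-- when every `q_i·n` is an integer: no inconsistent `α` has `H_α` active
at `(π, n)` iff every effective refinement of `π` at `n` is consistent. -/
theorem stmt_10 (p : ℕ) (hp : 1 ≤ p) (f : Judg p → Bool)
    (q : Fin (p + 1) → ℝ) (hq : ∀ i, q i ∈ Set.Icc (0 : ℝ) 1)
    (d : Fin (p + 1) → Bool) (n : ℕ) (hn : 1 ≤ n)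
    (hint : ∀ i : Fin (p + 1), ∃ k : ℤ, q i * (n : ℝ) = (k : ℝ))
    (π : Judg p → ℝ) (hπ : IsDistribution p π) :
    (∀ α : Fin (p + 1) → Bool, ¬ Consistent p f α →
        ¬ (π ∈ coneH p f q α ∧ ∃ P : Fin n → Judg p, HistR p n P ∈ polyH p f q d α)) ↔
      (∀ α : Fin (p + 1) → Bool, EffRef p n f q d π α → Consistent p f α) := by
  refine forall_congr' fun α => ?_
  simp only [HistR_mem_polyH_iff p n f q d hint, mem_coneH_iff p f q d π hπ.2, EffRef]
  exact not_imp_not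

end
end

section
/- Let Π be a closed and strictly positive set of distributions on {0,1}^p, let r be a quota rule and f a logical connection, and suppose condition κ4 holds. Then there exists a constant C > 0, depending only on Π, q, d, and f, such that for every n ≥ 1, DP^max(n) ≤ C·n^{−1/2}. -/
noncomputable section

/-- Orthogonality of the characters `t ↦ exp (i m t)` on `[-π, π]`. -/
lemma integral_cexp_int_mul_I (m : ℤ) :
    ∫ t in (-Real.pi)..Real.pi, Complex.exp (m * Complex.I * t) =
      if m = 0 then (2 * Real.pi : ℂ) else 0 := by
  split_ifs with h
  · subst h
    simp
    ring
  · have hc : (m : ℂ) * Complex.I ≠ 0 := by simp [h]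
    have hexp : Complex.exp (m * Complex.I * (Real.pi : ℝ)) =
        Complex.exp (m * Complex.I * ((-Real.pi : ℝ) : ℂ)) :=
      Complex.exp_eq_exp_iff_exists_int.2 ⟨m, by push_cast; ring⟩
    rw [integral_exp_mul_complex hc, hexp, sub_self, zero_div]

/-- The characteristic function of a Bernoulli variable that is not nearly deterministic
is dominated by a Gaussian on `[-π, π]`. -/
lemma norm_bernoulli_charFun_le {ε x t : ℝ} (hε : 0 ≤ ε) (hx : ε ≤ x) (hx' : ε ≤ 1 - x)
    (ht : |t| ≤ Real.pi) :
    ‖((1 - x : ℝ) : ℂ) + (x : ℂ) * Complex.exp (t * Complex.I)‖ ≤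
      Real.exp (-(2 * ε ^ 2 / Real.pi ^ 2) * t ^ 2) := by
  rw [← sq_le_sq₀ (norm_nonneg _) (Real.exp_nonneg _), ← Real.exp_nat_mul, Complex.sq_norm,
    Complex.exp_mul_I, ← Complex.ofReal_cos, ← Complex.ofReal_sin]
  have hre : Complex.normSq (((1 - x : ℝ) : ℂ) +
      (x : ℂ) * ((Real.cos t : ℝ) + (Real.sin t : ℝ) * Complex.I)) =
      1 - 2 * (x * (1 - x)) * (1 - Real.cos t) := by
    rw [Complex.normSq_apply]
    simp only [Complex.add_re, Complex.add_im, Complex.mul_re, Complex.mul_im,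
      Complex.ofReal_re, Complex.ofReal_im, Complex.I_re, Complex.I_im]
    linear_combination x ^ 2 * Real.sin_sq_add_cos_sq t
  have hcos : 2 / Real.pi ^ 2 * t ^ 2 ≤ 1 - Real.cos t := by
    linarith [Real.cos_le_one_sub_mul_cos_sq ht]
  have hvar : ε ^ 2 ≤ x * (1 - x) := by
    rw [sq]; exact mul_le_mul hx hx' hε (hε.trans hx)
  have hmul : ε ^ 2 * (2 / Real.pi ^ 2 * t ^ 2) ≤ x * (1 - x) * (1 - Real.cos t) :=
    mul_le_mul hvar hcos (by positivity) ((sq_nonneg ε).trans hvar)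
  rw [hre]
  calc 1 - 2 * (x * (1 - x)) * (1 - Real.cos t)
      ≤ (-(2 * (ε ^ 2 * (2 / Real.pi ^ 2 * t ^ 2)))) + 1 := by linarith
    _ ≤ Real.exp (-(2 * (ε ^ 2 * (2 / Real.pi ^ 2 * t ^ 2)))) := Real.add_one_le_exp _
    _ = _ := by congr 1; push_cast; ring

/-- Anticoncentration for sums of independent, non-identical Bernoulli variables: if each
`v j` gives mass at least `ε` to both `A` and its complement, the number of samples that
land in `A` equals any given `k` with probability `O(n^{-1/2})`. -/
lemma prob_count_eq_le {α : Type*} [Fintype α] [DecidableEq α] (A : Finset α) {n : ℕ}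
    (hn : 1 ≤ n) {ε : ℝ} (hε : 0 < ε) (v : Fin n → α → ℝ) (hsum : ∀ j, ∑ a, v j a = 1)
    (hA : ∀ j, ε ≤ ∑ a ∈ A, v j a) (hA' : ∀ j, ε ≤ 1 - ∑ a ∈ A, v j a) (k : ℕ) :
    (∑ P : Fin n → α,
      if (∑ j, if P j ∈ A then 1 else 0) = k then ∏ j, v j (P j) else 0) ≤
      √(Real.pi / (2 * ε ^ 2 / Real.pi ^ 2)) / (2 * Real.pi) / √n := by
  have hpi := Real.pi_pos
  set b : ℝ := 2 * ε ^ 2 / Real.pi ^ 2 with hb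
  have hb0 : 0 < b := by positivity
  have hn0 : (0 : ℝ) < n := by exact_mod_cast hn
  set S : (Fin n → α) → ℕ := fun P => ∑ j, if P j ∈ A then 1 else 0 with hS
  set T : ℝ := ∑ P : Fin n → α, if S P = k then ∏ j, v j (P j) else 0 with hT
  set φ : Fin n → ℝ → ℂ := fun j t =>
    ((1 - ∑ a ∈ A, v j a : ℝ) : ℂ) + ((∑ a ∈ A, v j a : ℝ) : ℂ) * Complex.exp (t * Complex.I)
    with hφ
  have hφ_sum (j : Fin n) (t : ℝ) : φ j t =
      ∑ a, (v j a : ℂ) * Complex.exp ((if a ∈ A then 1 else 0 : ℕ) * (t * Complex.I)) := by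
    have hsplit : 1 - ∑ a ∈ A, v j a = ∑ a ∈ Aᶜ, v j a := by
      rw [← hsum j, ← Finset.sum_add_sum_compl A]; ring
    rw [← Finset.sum_add_sum_compl A, hφ]
    simp only [hsplit]
    push_cast
    rw [add_comm, Finset.sum_mul]
    congr 1
    · exact Finset.sum_congr rfl fun a ha => by simp [ha]
    · exact Finset.sum_congr rfl fun a ha => by simp [Finset.mem_compl.1 ha]
  have hprod (t : ℝ) : ∏ j, φ j t =
      ∑ P : Fin n → α, ((∏ j, v j (P j) : ℝ) : ℂ) * Complex.exp (S P * (t * Complex.I)) := by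
    simp_rw [hφ_sum]
    rw [Finset.prod_univ_sum, Fintype.piFinset_univ]
    refine Finset.sum_congr rfl fun P _ => ?_
    rw [Finset.prod_mul_distrib, ← Complex.exp_sum, ← Finset.sum_mul, hS]
    push_cast
    rfl
  have hfourier : ∫ t in (-Real.pi)..Real.pi,
      Complex.exp (-(k : ℂ) * (t * Complex.I)) * ∏ j, φ j t = 2 * Real.pi * (T : ℂ) := by
    have hterm (t : ℝ) : Complex.exp (-(k : ℂ) * (t * Complex.I)) * ∏ j, φ j t =
        ∑ P : Fin n → α, ((∏ j, v j (P j) : ℝ) : ℂ) *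
          Complex.exp (((S P - k : ℤ) : ℂ) * Complex.I * t) := by
      rw [hprod, Finset.mul_sum]
      refine Finset.sum_congr rfl fun P _ => ?_
      rw [mul_left_comm, ← Complex.exp_add]
      congr 2
      push_cast
      ring
    simp_rw [hterm]
    rw [intervalIntegral.integral_finsetSum
      fun P _ => (by fun_prop : Continuous _).intervalIntegrable _ _, hT]
    push_cast
    rw [Finset.mul_sum]
    refine Finset.sum_congr rfl fun P _ => ?_
    have h := integral_cexp_int_mul_I (S P - k)
    push_cast at h
    rw [intervalIntegral.integral_const_mul, h]
    simp only [sub_eq_zero, Nat.cast_inj]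
    split_ifs <;> push_cast <;> ring
  have hbound (t : ℝ) (ht : t ∈ Set.Ioc (-Real.pi) Real.pi) :
      ‖Complex.exp (-(k : ℂ) * (t * Complex.I)) * ∏ j, φ j t‖ ≤
        Real.exp (-(n * b) * t ^ 2) := by
    have hone : ‖Complex.exp (-(k : ℂ) * (t * Complex.I))‖ = 1 := by
      rw [show -(k : ℂ) * (t * Complex.I) = ((-k * t : ℝ) : ℂ) * Complex.I by push_cast; ring]
      exact Complex.norm_exp_ofReal_mul_I _
    rw [norm_mul, hone, one_mul, norm_prod]
    calc ∏ j, ‖φ j t‖ ≤ ∏ _j : Fin n, Real.exp (-b * t ^ 2) :=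
          Finset.prod_le_prod (fun _ _ => norm_nonneg _) fun j _ =>
            norm_bernoulli_charFun_le hε.le (hA j) (hA' j) (abs_le.2 ⟨ht.1.le, ht.2⟩)
      _ = Real.exp (-(n * b) * t ^ 2) := by
          rw [Finset.prod_const, Finset.card_univ, Fintype.card_fin, ← Real.exp_nat_mul]
          congr 1
          ring
  have hgauss := integrable_exp_neg_mul_sq (mul_pos hn0 hb0)
  have hle : 2 * Real.pi * T ≤ √(Real.pi / (n * b)) := by
    calc 2 * Real.pi * T ≤ ‖(2 * Real.pi * (T : ℂ))‖ := by
          rw [show (2 * Real.pi * (T : ℂ)) = ((2 * Real.pi * T : ℝ) : ℂ) by push_cast; ring,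
            Complex.norm_real]
          exact le_abs_self _
      _ ≤ ∫ t in (-Real.pi)..Real.pi, Real.exp (-(n * b) * t ^ 2) := by
          rw [← hfourier]
          exact intervalIntegral.norm_integral_le_of_norm_le (by linarith)
            (Filter.Eventually.of_forall hbound) hgauss.intervalIntegrable
      _ ≤ ∫ t, Real.exp (-(n * b) * t ^ 2) := by
          rw [intervalIntegral.integral_of_le (by linarith)]
          exact MeasureTheory.setIntegral_le_integral hgauss
            (Filter.Eventually.of_forall fun _ => (Real.exp_pos _).le)
      _ = √(Real.pi / (n * b)) := integral_gaussian _
  have hsqrt : √(Real.pi / (n * b)) = √(Real.pi / b) / √n := by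
    rw [← Real.sqrt_div (by positivity), div_div, mul_comm b]
  rw [hsqrt] at hle
  rw [div_right_comm, le_div_iff₀ (by positivity)]
  linarith

lemma nOnes_eq_sum (p n : ℕ) (f : Judg p → Bool) (P : Fin n → Judg p) (i : Fin (p + 1)) :
    nOnes p n f P i = ∑ j, if P j ∈ Omega p f i then 1 else 0 := by
  simp only [nOnes, Hist, Finset.card_filter]
  rw [Finset.sum_comm]
  simp

lemma mem_Omega_castSucc {p : ℕ} {f : Judg p → Bool} {i : Fin p} {ω : Judg p} :
    ω ∈ Omega p f i.castSucc ↔ ω i = true := by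
  simp [Omega]

lemma mem_Omega_last {p : ℕ} {f : Judg p → Bool} {ω : Judg p} :
    ω ∈ Omega p f (Fin.last p) ↔ f ω = true := by
  simp [Omega]

lemma quota_of_ne {p n : ℕ} {f : Judg p → Bool} {q : Fin (p + 1) → ℝ}
    (d : Fin (p + 1) → Bool) {P : Fin n → Judg p} {i : Fin (p + 1)}
    (h : (nOnes p n f P i : ℝ) ≠ q i * n) :
    quota p n f q d P i = true ↔ q i * n < nOnes p n f P i := by
  simp [quota, h]

/-- If the conclusion copies or negates premise `i` with matching thresholds, a doctrinal
paradox forces a tie on premise `i`. -/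
lemma Paradox.tie {p n : ℕ} {f : Judg p → Bool} {q : Fin (p + 1) → ℝ}
    {d : Fin (p + 1) → Bool} {P : Fin n → Judg p} {i : Fin p}
    (hi : ((∀ ω : Judg p, f ω = ω i) ∧ q (Fin.last p) = q i.castSucc) ∨
      ((∀ ω : Judg p, f ω = !(ω i)) ∧ q (Fin.last p) = 1 - q i.castSucc))
    (hP : Paradox p n f q d P) :
    (nOnes p n f P i.castSucc : ℝ) = q i.castSucc * n := by
  by_contra hne
  refine hP ?_
  rw [Consistent]
  rcases hi with ⟨hf, hq⟩ | ⟨hf, hq⟩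
  · have hcount : nOnes p n f P (Fin.last p) = nOnes p n f P i.castSucc := by
      simp only [nOnes_eq_sum, mem_Omega_last, mem_Omega_castSucc, hf]
    rw [hf, Bool.eq_iff_iff, quota_of_ne d hne, quota_of_ne d (by rwa [hcount, hq]), hcount, hq]
  · have hcount : nOnes p n f P (Fin.last p) + nOnes p n f P i.castSucc = n := by
      simp only [nOnes_eq_sum, mem_Omega_last, mem_Omega_castSucc, hf]
      rw [← Finset.sum_add_distrib]
      trans ∑ _j : Fin n, 1
      · refine Finset.sum_congr rfl fun j _ => ?_
        cases P j i <;> rfl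
      · simp
    have hcast : (nOnes p n f P (Fin.last p) : ℝ) = n - nOnes p n f P i.castSucc := by
      rw [eq_sub_iff_add_eq]; exact_mod_cast hcount
    have hne' : (nOnes p n f P (Fin.last p) : ℝ) ≠ q (Fin.last p) * n := by
      rw [hcast, hq]
      intro h
      exact hne (by linarith)
    rw [hf, Bool.eq_iff_iff, quota_of_ne d hne', Bool.not_eq_true', ← Bool.not_eq_true,
      quota_of_ne d hne, hcast, hq, not_lt]
    constructor
    · intro h
      linarith
    · intro h
      have := lt_of_le_of_ne h hne
      linarith

/-- if κ4 holds, there is `C > 0` with `DP^max(n) ≤ C·n^{−1/2}` for all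
`n ≥ 1`. -/
theorem stmt_13 (p : ℕ) (hp : 1 ≤ p) (f : Judg p → Bool)
    (q : Fin (p + 1) → ℝ) (hq : ∀ i, q i ∈ Set.Icc (0 : ℝ) 1)
    (d : Fin (p + 1) → Bool) (D : Set (Judg p → ℝ)) (hne : D.Nonempty)
    (hcl : IsClosed D) (hsp : StrictlyPositive p D)
    (hdist : ∀ π ∈ D, IsDistribution p π) (hk4 : kappa4 p f q) :
    ∃ C > (0 : ℝ), ∀ n : ℕ, 1 ≤ n →
      DPmax p n f q d D ≤ C * (n : ℝ) ^ (-(1 : ℝ) / 2) := by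
  obtain ⟨i, hi⟩ := hk4
  obtain ⟨ε, hε, hεD⟩ := hsp
  have hpi := Real.pi_pos
  refine ⟨√(Real.pi / (2 * ε ^ 2 / Real.pi ^ 2)) / (2 * Real.pi), by positivity, fun n hn => ?_⟩
  have hpow : (n : ℝ) ^ (-(1 : ℝ) / 2) = (√n)⁻¹ := by
    rw [neg_div, Real.rpow_neg n.cast_nonneg, Real.sqrt_eq_rpow]
  rw [hpow, ← div_eq_mul_inv]
  refine Real.sSup_le ?_ (by positivity)
  rintro _ ⟨vπ, hv, rfl⟩
  have hprod (P : Fin n → Judg p) : 0 ≤ ∏ j, vπ j (P j) :=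
    Finset.prod_nonneg fun j _ => (hdist _ (hv j)).1 _
  by_cases hex : ∃ k : ℕ, (k : ℝ) = q i.castSucc * n
  · obtain ⟨k, hk⟩ := hex
    have hmass (B : Finset (Judg p)) (ω : Judg p) (hω : ω ∈ B) (j : Fin n) :
        ε ≤ ∑ ω ∈ B, vπ j ω :=
      (hεD _ (hv j) ω).trans
        (Finset.single_le_sum (fun ω _ => (hdist _ (hv j)).1 ω) hω)
    refine le_trans ?_ (prob_count_eq_le (Omega p f i.castSucc) hn hε vπ
      (fun j => (hdist _ (hv j)).2)
      (hmass _ (fun _ => true) (mem_Omega_castSucc.2 rfl)) (fun j => ?_) k)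
    · refine Finset.sum_le_sum fun P _ => ?_
      by_cases hP : Paradox p n f q d P
      · have htie : (∑ j, if P j ∈ Omega p f i.castSucc then 1 else 0) = k := by
          rw [← nOnes_eq_sum]
          exact_mod_cast (hP.tie hi).trans hk.symm
        rw [if_pos hP, if_pos htie]
      · rw [if_neg hP]
        split_ifs
        exacts [hprod P, le_rfl]
    · have hcompl := hmass (Omega p f i.castSucc)ᶜ (fun _ => false)
        (by simp [mem_Omega_castSucc]) j
      rw [← (hdist _ (hv j)).2, ← Finset.sum_add_sum_compl (Omega p f i.castSucc)]
      linarith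
  · have hzero : probParadox p n f q d vπ = 0 :=
      Finset.sum_eq_zero fun P _ => if_neg fun hP => hex ⟨_, hP.tie hi⟩
    rw [hzero]
    positivity

end
end
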